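/- Let f : ℝ × ℝ^n → ℝ^n, g : ℝ × ℝ^n → ℝ^{n×m} and φ : ℝ × ℝ^n → ℝ^r be infinitely differentiable with r = m. Assume φ has relative degree ρ ∈ ℕ^r with respect to (f,g), and that the r×m matrix Ω_g(t,x), whose k-th row is L_g L_f^{ρ_k−1} φ_k(t,x), is invertible for every (t,x). Fix t0 < T, x0 ∈ ℝ^n, and real initial values z_k^{(i)}(t0) for k ∈ {1,…,r} and 0 ≤ i ≤ ρ_k − 1 such that φ_k(t0,x0) + z_k(t0)²/2 = 0 and, for every 1 ≤ i ≤ ρ_k − 1, L_f^i φ_k(t0,x0) + z_k(t0)·z_k^{(i)}(t0) + (1/2)·Σ_{j=1}^{i−1} binom(i,j)·z_k^{(i−j)}(t0)·z_k^{(j)}(t0) = 0. Let β > 0, let ξ : [t0,T] → ℝ^r be continuous, and define w : [t0,T] → ℝ^r componentwise by w_k(t) = s_β(ξ_k(t)) where s_β(v) = 2β(1/(e^{−v}+1) − 1/2). Define z_k^{(i)} on [t0,T] by repeated integration of w as in Theorem 1, u(s) = −Ω_g(s,x(s))^{-1}·( Ω_f(s) + D(z(s))·w(s) ) with D(z(s))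 = diag(z_1(s),…,z_r(s)) and Ω_f(s) ∈ ℝ^r having k-th entry L_f^{ρ_k} φ_k(s,x(s)) + (1/2)·Σ_{j=1}^{ρ_k−1} binom(ρ_k,j)·z_k^{(ρ_k−j)}(s)·z_k^{(j)}(s), and suppose x : [t0,T] → ℝ^n is continuous with u integrable and x(t) = x0 + ∫_{t0}^t ( f(s,x(s)) + g(s,x(s))·u(s) ) ds for all t ∈ [t0,T]. Then w is Lebesgue integrable on [t0,T] with |w_k(t)| ≤ β for all t and k, and consequently φ_k(t,x(t)) ≤ 0 for every t ∈ [t0,T] and every k ∈ {1,…,r}. -/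

import Mathlib

noncomputable section

open Real MeasureTheory Finset

/-- One-step Lie derivative of a scalar function `ψ` along the time-varying vector field `f`:
`L_f ψ (t,x) = (∂ₓ ψ)(t,x) · f(t,x) + (∂ₜ ψ)(t,x)`, expressed as the total (Fréchet)
derivative of `ψ` in the direction `(1, f(t,x))`. -/
def lieF {n : ℕ} (f : ℝ × (Fin n → ℝ) → Fin n → ℝ) (ψ : ℝ × (Fin n → ℝ) → ℝ) :
    ℝ × (Fin n → ℝ) → ℝ :=
  fun p => fderiv ℝ ψ p (1, f p)

/-- Iterated Lie derivative `L_f^j ψ`, with `L_f^0 ψ = ψ`. -/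
def lieFIter {n : ℕ} (f : ℝ × (Fin n → ℝ) → Fin n → ℝ) (ψ : ℝ × (Fin n → ℝ) → ℝ)
    (j : ℕ) : ℝ × (Fin n → ℝ) → ℝ :=
  (lieF f)^[j] ψ

/-- Mixed Lie derivative `L_g ψ (t,x) = (∂ₓ ψ)(t,x) · g(t,x) ∈ ℝ^{1×m}` as a row vector;
the `i`-th component is the derivative of `ψ` in the (space) direction of the `i`-th
column of `g`. -/
def lieG {n m : ℕ} (g : ℝ × (Fin n → ℝ) → Fin n → Fin m → ℝ)
    (ψ : ℝ × (Fin n → ℝ) → ℝ) : ℝ × (Fin n → ℝ) → Fin m → ℝ :=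
  fun p i => fderiv ℝ ψ p (0, fun a => g p a i)

/-- The bounded saturation function `s_β(v) = 2β(1/(e^{-v}+1) - 1/2)` (Eq. (16) of the paper). -/
def sBeta (β v : ℝ) : ℝ := 2 * β * (1 / (Real.exp (-v) + 1) - 1 / 2)

/-- A function given on `[a, b]` by integrating a continuous function has that function as its
derivative within `[a, b]`. -/
theorem hasDerivWithinAt_of_eq_add_integral {E : Type*} [NormedAddCommGroup E] [NormedSpace ℝ E]
    [CompleteSpace E] {F G : ℝ → E} {a b : ℝ} {c : E} (hab : a ≤ b)
    (hF : ContinuousOn F (Set.Icc a b))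
    (hG : ∀ t ∈ Set.Icc a b, G t = c + ∫ s in a..t, F s) :
    ∀ t ∈ Set.Icc a b, HasDerivWithinAt G (F t) (Set.Icc a b) t := by
  intro t ht
  set F' : ℝ → E := fun s => F (Set.projIcc a b hab s) with hF'
  have hcont : Continuous F' :=
    hF.comp_continuous (continuous_subtype_val.comp continuous_projIcc) fun s =>
      (Set.projIcc a b hab s).2
  have heq : ∀ s ∈ Set.Icc a b, F' s = F s := fun s hs => by
    simp only [hF', Set.projIcc_of_mem hab hs]
  have hd : HasDerivAt (fun t => c + ∫ s in a..t, F' s) (F' t) t :=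
    (hcont.integral_hasStrictDerivAt a t).hasDerivAt.const_add c
  rw [← heq t ht]
  refine hd.hasDerivWithinAt.congr_of_mem (fun r hr => ?_) ht
  rw [hG r hr]
  congr 1
  refine intervalIntegral.integral_congr fun s hs => ?_
  rw [Set.uIcc_of_le hr.1] at hs
  exact (heq s ⟨hs.1, hs.2.trans hr.2⟩).symm

/-- A chain of functions, each the derivative of the previous one, that ends in the zero function
and has zero initial values consists of zero functions. -/
theorem eq_zero_of_hasDerivWithinAt_chain {a b : ℝ} {N : ℕ} {e : ℕ → ℝ → ℝ}
    (hd : ∀ i < N, ∀ t ∈ Set.Icc a b, HasDerivWithinAt (e i) (e (i + 1) t) (Set.Icc a b) t)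
    (h0 : ∀ i < N, e i a = 0) (hN : ∀ t ∈ Set.Icc a b, e N t = 0) :
    ∀ i ≤ N, ∀ t ∈ Set.Icc a b, e i t = 0 := by
  intro i hi
  induction hi using Nat.decreasingInduction with
  | self => exact hN
  | of_succ i hi ih =>
    intro t ht
    rw [← h0 i hi]
    refine constant_of_has_deriv_right_zero (fun s hs => (hd i hi s hs).continuousWithinAt)
      (fun s hs => ?_) t ht
    have := hd i hi s ⟨hs.1, hs.2.le⟩
    rw [ih s ⟨hs.1, hs.2.le⟩] at this
    exact this.mono_of_mem_nhdsWithin (Icc_mem_nhdsGE_of_mem hs)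

/-- The formal `i`-th derivative of `z² / 2`, where `z j` stands for the `j`-th derivative of
`z`. -/
def halfSqDeriv (z : ℕ → ℝ) (i : ℕ) : ℝ :=
  (1 / 2) * ∑ p ∈ Finset.HasAntidiagonal.antidiagonal i, (i.choose p.1 : ℝ) * (z p.1 * z p.2)

theorem halfSqDeriv_zero (z : ℕ → ℝ) : halfSqDeriv z 0 = z 0 ^ 2 / 2 := by
  simp [halfSqDeriv]
  ring

theorem halfSqDeriv_of_pos (z : ℕ → ℝ) {i : ℕ} (hi : 1 ≤ i) :
    halfSqDeriv z i = z 0 * z i +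
      (1 / 2) * ∑ j ∈ Finset.Ico 1 i, (i.choose j : ℝ) * z (i - j) * z j := by
  rw [halfSqDeriv, Finset.Nat.sum_antidiagonal_eq_sum_range_succ
    (fun p q => (i.choose p : ℝ) * (z p * z q)), Finset.sum_range_succ, Finset.range_eq_Ico,
    Finset.sum_eq_sum_Ico_succ_bot hi]
  have : ∑ j ∈ Finset.Ico (0 + 1) i, (i.choose j : ℝ) * (z j * z (i - j)) =
      ∑ j ∈ Finset.Ico 1 i, (i.choose j : ℝ) * z (i - j) * z j :=
    Finset.sum_congr rfl fun j _ => by ring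
  rw [this]
  simp
  ring

theorem hasDerivWithinAt_halfSqDeriv {z : ℕ → ℝ → ℝ} {s : Set ℝ} {t : ℝ} {i : ℕ}
    (hz : ∀ j ≤ i, HasDerivWithinAt (z j) (z (j + 1) t) s t) :
    HasDerivWithinAt (fun r => halfSqDeriv (fun j => z j r) i)
      (halfSqDeriv (fun j => z j t) (i + 1)) s t := by
  have hsum : HasDerivWithinAt
      (fun r => ∑ p ∈ Finset.HasAntidiagonal.antidiagonal i, (i.choose p.1 : ℝ) * (z p.1 r * z p.2 r))
      (∑ p ∈ Finset.HasAntidiagonal.antidiagonal i, (i.choose p.1 : ℝ) *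
        (z (p.1 + 1) t * z p.2 t + z p.1 t * z (p.2 + 1) t)) s t := by
    refine HasDerivWithinAt.fun_sum fun p hp => ?_
    have hp' := Finset.HasAntidiagonal.mem_antidiagonal.mp hp
    exact ((hz p.1 (by omega)).fun_mul (hz p.2 (by omega))).const_mul _
  refine (hsum.const_mul (1 / 2 : ℝ)).congr_deriv ?_
  rw [halfSqDeriv, Finset.sum_antidiagonal_choose_succ_mul (fun p q => z p t * z q t),
    ← Finset.sum_add_distrib]
  congr 1
  refine Finset.sum_congr rfl fun p hp => ?_
  rw [← Nat.choose_symm_of_eq_add (Finset.HasAntidiagonal.mem_antidiagonal.mp hp).symm]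
  ring

section LieDerivatives

variable {n m : ℕ} {f : ℝ × (Fin n → ℝ) → Fin n → ℝ} {ψ : ℝ × (Fin n → ℝ) → ℝ}

theorem lieFIter_succ (j : ℕ) : lieFIter f ψ (j + 1) = lieF f (lieFIter f ψ j) :=
  Function.iterate_succ_apply' _ _ _

theorem contDiff_lieF (hf : ContDiff ℝ (⊤ : ℕ∞) f) (hψ : ContDiff ℝ (⊤ : ℕ∞) ψ) :
    ContDiff ℝ (⊤ : ℕ∞) (lieF f ψ) :=
  (hψ.fderiv_right (m := ((⊤ : ℕ∞) : WithTop ℕ∞)) (by simp)).clm_apply (contDiff_const.prodMk hf)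

theorem contDiff_lieFIter (hf : ContDiff ℝ (⊤ : ℕ∞) f) (hψ : ContDiff ℝ (⊤ : ℕ∞) ψ) (j : ℕ) :
    ContDiff ℝ (⊤ : ℕ∞) (lieFIter f ψ j) := by
  induction j with
  | zero => exact hψ
  | succ j ih => rw [lieFIter_succ]; exact contDiff_lieF hf ih

theorem continuous_lieG_apply {g : ℝ × (Fin n → ℝ) → Fin n → Fin m → ℝ}
    (hg : Continuous g) (hψ : ContDiff ℝ (⊤ : ℕ∞) ψ) (i : Fin m) :
    Continuous fun p => lieG g ψ p i := by
  refine (hψ.continuous_fderiv (by simp)).clm_apply (continuous_const.prodMk ?_)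
  fun_prop

/-- The chain rule along a trajectory of `x' = f(t,x) + g(t,x) v`. -/
theorem hasDerivWithinAt_comp_trajectory {g : ℝ × (Fin n → ℝ) → Fin n → Fin m → ℝ}
    (hψ : Differentiable ℝ ψ) {x : ℝ → Fin n → ℝ} {v : Fin m → ℝ} {s : Set ℝ} {t : ℝ}
    (hx : HasDerivWithinAt x (fun a => f (t, x t) a + ∑ i, g (t, x t) a i * v i) s t) :
    HasDerivWithinAt (fun r => ψ (r, x r))
      (lieF f ψ (t, x t) + ∑ i, lieG g ψ (t, x t) i * v i) s t := by
  have h := (hψ (t, x t)).hasFDerivAt.comp_hasDerivWithinAt t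
    ((hasDerivWithinAt_id t s).prodMk hx)
  refine h.congr_deriv ?_
  have hdir : ((1 : ℝ), fun a => f (t, x t) a + ∑ i, g (t, x t) a i * v i) =
      (1, f (t, x t)) + ∑ i, v i • ((0 : ℝ), fun a => g (t, x t) a i) := by
    ext a
    · simp [Prod.fst_sum]
    · simp [Prod.snd_sum, mul_comm]
  rw [hdir, map_add, map_sum]
  simp only [map_smul, smul_eq_mul, lieF, lieG, mul_comm]

end LieDerivatives

theorem continuous_sBeta (β : ℝ) : Continuous (sBeta β) := by
  unfold sBeta
  fun_prop (disch := intro x; positivity)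

theorem abs_sBeta_le {β : ℝ} (hβ : 0 < β) (v : ℝ) : |sBeta β v| ≤ β := by
  have hpos : 0 ≤ 1 / (Real.exp (-v) + 1) := by positivity
  have hle : 1 / (Real.exp (-v) + 1) ≤ 1 := by
    rw [div_le_one (by positivity)]
    linarith [Real.exp_pos (-v)]
  rw [sBeta, abs_le]
  constructor <;> nlinarith

/-- **Integral controller structure guarantees integrability and constraint satisfaction**
(end of Section 3.1 of the paper). With `w = s_β(ξ)` for a continuous `ξ`, the virtual
input `w` is integrable and bounded by `β`, and hence (by Theorem 1) the closed-loop
trajectory satisfies `φ(t,x(t)) ≤ 0`. -/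
theorem integral_controller_implies_constraint_satisfaction
    {n m : ℕ} (f : ℝ × (Fin n → ℝ) → Fin n → ℝ)
    (g : ℝ × (Fin n → ℝ) → Fin n → Fin m → ℝ)
    (φ : ℝ × (Fin n → ℝ) → Fin m → ℝ)   -- `r = m`
    (hf : ContDiff ℝ (⊤ : ℕ∞) f) (hg : ContDiff ℝ (⊤ : ℕ∞) g)
    (hφ : ContDiff ℝ (⊤ : ℕ∞) φ)
    (ρ : Fin m → ℕ) (hρ : ∀ k, 1 ≤ ρ k)
    -- relative degree of `φ` with respect to `(f,g)`
    (hrel1 : ∀ k : Fin m, ∀ i : ℕ, i + 2 ≤ ρ k →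
      ∀ p : ℝ × (Fin n → ℝ), lieG g (lieFIter f (fun q => φ q k) i) p = 0)
    (hrel2 : ∀ k : Fin m, ∀ p : ℝ × (Fin n → ℝ),
      lieG g (lieFIter f (fun q => φ q k) (ρ k - 1)) p ≠ 0)
    -- `Ω_g(t,x)` is invertible everywhere
    (hΩ : ∀ p : ℝ × (Fin n → ℝ), IsUnit
      ((Matrix.of fun k i => lieG g (lieFIter f (fun q => φ q k) (ρ k - 1)) p i) :
        Matrix (Fin m) (Fin m) ℝ))
    (t0 T : ℝ) (hT : t0 < T) (x0 : Fin n → ℝ)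
    -- initial values `z0 k i = z_k^{(i)}(t0)`
    (z0 : Fin m → ℕ → ℝ)
    (hz00 : ∀ k, φ (t0, x0) k + z0 k 0 ^ 2 / 2 = 0)
    (hz0i : ∀ k, ∀ i : ℕ, 1 ≤ i → i ≤ ρ k - 1 →
      lieFIter f (fun q => φ q k) i (t0, x0) + z0 k 0 * z0 k i +
        (1 / 2) * ∑ j ∈ Finset.Ico 1 i, (i.choose j : ℝ) * z0 k (i - j) * z0 k j = 0)
    -- the integral controller structure: `w_k(t) = s_β(ξ_k(t))` with `ξ` continuous
    (β : ℝ) (hβ : 0 < β)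
    (ξ : ℝ → Fin m → ℝ) (hξ : ContinuousOn ξ (Set.Icc t0 T))
    (w : ℝ → Fin m → ℝ) (hwdef : ∀ t, ∀ k, w t k = sBeta β (ξ t k))
    -- `Z k i = z_k^{(i)}`, defined by repeated integration of `w`
    (Z : Fin m → ℕ → ℝ → ℝ)
    (hZtop : ∀ k, ∀ t ∈ Set.Icc t0 T,
      Z k (ρ k - 1) t = z0 k (ρ k - 1) + ∫ s in t0..t, w s k)
    (hZstep : ∀ k, ∀ i : ℕ, 1 ≤ i → i ≤ ρ k - 1 → ∀ t ∈ Set.Icc t0 T,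
      Z k (i - 1) t = z0 k (i - 1) + ∫ s in t0..t, Z k i s)
    (x : ℝ → Fin n → ℝ) (hxc : ContinuousOn x (Set.Icc t0 T))
    -- the controller `u(s) = -Ω_g(s,x(s))⁻¹ ( Ω_f(s) + D(z(s))·w(s) )`
    (u : ℝ → Fin m → ℝ)
    (hu : ∀ s ∈ Set.Icc t0 T, u s =
      -(((Matrix.of fun k i =>
            lieG g (lieFIter f (fun q => φ q k) (ρ k - 1)) (s, x s) i) :
          Matrix (Fin m) (Fin m) ℝ)⁻¹).mulVec
        (fun k => (lieFIter f (fun q => φ q k) (ρ k) (s, x s) +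
            (1 / 2) * ∑ j ∈ Finset.Ico 1 (ρ k), ((ρ k).choose j : ℝ) *
              Z k (ρ k - j) s * Z k j s) + Z k 0 s * w s k))
    (huint : IntegrableOn u (Set.Icc t0 T))
    -- `x` solves the integral equation of the closed loop
    (hx : ∀ t ∈ Set.Icc t0 T, x t = x0 + ∫ s in t0..t,
      (fun a => f (s, x s) a + ∑ i, g (s, x s) a i * u s i)) :
    IntegrableOn w (Set.Icc t0 T) ∧
    (∀ t ∈ Set.Icc t0 T, ∀ k, |w t k| ≤ β) ∧
    (∀ t ∈ Set.Icc t0 T, ∀ k, φ (t, x t) k ≤ 0) := by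
  have hwcont : ∀ k, ContinuousOn (fun s => w s k) (Set.Icc t0 T) := fun k => by
    simp only [hwdef]
    exact (continuous_sBeta β).comp_continuousOn (continuousOn_pi.mp hξ k)
  refine ⟨(continuousOn_pi.mpr hwcont).integrableOn_Icc, fun t _ k => by
    rw [hwdef]; exact abs_sBeta_le hβ _, ?_⟩
  -- `z k j` extends `Z k j`, `j < ρ k`, by the virtual input as the derivative of order `ρ k`
  let z : Fin m → ℕ → ℝ → ℝ := fun k j s => if j < ρ k then Z k j s else w s k
  have hz_lt : ∀ k j, j < ρ k → z k j = Z k j := fun k j hj => by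
    funext s; simp only [z, if_pos hj]
  have hz_top : ∀ k, z k (ρ k) = fun s => w s k := fun k => by
    funext s; simp only [z, lt_irrefl, if_false]
  have hz_int : ∀ k, ∀ j < ρ k, ∀ t ∈ Set.Icc t0 T,
      z k j t = z0 k j + ∫ s in t0..t, z k (j + 1) s := by
    intro k j hj t ht
    rw [hz_lt k j hj]
    rcases Nat.lt_or_ge (j + 1) (ρ k) with h | h
    · rw [hz_lt k _ h]
      exact hZstep k (j + 1) (by omega) (by omega) t ht
    · obtain rfl : j = ρ k - 1 := by omega
      rw [Nat.sub_add_cancel (hρ k), hz_top]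
      exact hZtop k t ht
  have hz_cont : ∀ k, ∀ j ≤ ρ k, ContinuousOn (z k j) (Set.Icc t0 T) := by
    intro k j hj
    induction hj using Nat.decreasingInduction with
    | self => rw [hz_top]; exact hwcont k
    | of_succ j hj ih =>
      exact fun t ht =>
        (hasDerivWithinAt_of_eq_add_integral hT.le ih (hz_int k j hj) t ht).continuousWithinAt
  have hz_deriv : ∀ k, ∀ j < ρ k, ∀ t ∈ Set.Icc t0 T,
      HasDerivWithinAt (z k j) (z k (j + 1) t) (Set.Icc t0 T) t := fun k j hj =>
    hasDerivWithinAt_of_eq_add_integral hT.le (hz_cont k (j + 1) hj) (hz_int k j hj)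
  have hz_init : ∀ k, ∀ j < ρ k, z k j t0 = z0 k j := fun k j hj => by
    simpa using hz_int k j hj t0 (Set.left_mem_Icc.mpr hT.le)
  have hφk : ∀ k, ContDiff ℝ (⊤ : ℕ∞) fun q => φ q k := contDiff_pi.mp hφ
  -- the controller in terms of the formal derivatives of `z² / 2`
  let Ω : ℝ × (Fin n → ℝ) → Matrix (Fin m) (Fin m) ℝ := fun p =>
    Matrix.of fun k i => lieG g (lieFIter f (fun q => φ q k) (ρ k - 1)) p i
  let b : ℝ → Fin m → ℝ := fun s k =>
    lieFIter f (fun q => φ q k) (ρ k) (s, x s) + halfSqDeriv (fun j => z k j s) (ρ k)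
  have hu' : ∀ s ∈ Set.Icc t0 T, u s = -((Ω (s, x s))⁻¹.mulVec (b s)) := by
    intro s hs
    rw [hu s hs]
    congr 2
    funext k
    simp only [b]
    rw [halfSqDeriv_of_pos _ (hρ k), hz_lt k 0 (hρ k), hz_top]
    have : ∑ j ∈ Finset.Ico 1 (ρ k), ((ρ k).choose j : ℝ) * z k (ρ k - j) s * z k j s =
        ∑ j ∈ Finset.Ico 1 (ρ k), ((ρ k).choose j : ℝ) * Z k (ρ k - j) s * Z k j s :=
      Finset.sum_congr rfl fun j hj => by
        rw [Finset.mem_Ico] at hj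
        rw [hz_lt k _ hj.2, hz_lt k (ρ k - j) (by omega)]
    rw [this]
    ring
  have hpath : ContinuousOn (fun s => (s, x s)) (Set.Icc t0 T) := continuousOn_id.prodMk hxc
  have hΩcont : ContinuousOn (fun s => (Ω (s, x s))⁻¹) (Set.Icc t0 T) := by
    have hΩc : Continuous Ω := continuous_matrix fun k i =>
      continuous_lieG_apply hg.continuous (contDiff_lieFIter hf (hφk k) _) i
    intro s hs
    have hdet : IsUnit (Ω (s, x s)).det := (Matrix.isUnit_iff_isUnit_det _).mp (hΩ (s, x s))
    have hinv : ContinuousAt Ring.inverse (Ω (s, x s)).det := by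
      rw [Ring.inverse_eq_inv']
      exact continuousAt_inv₀ hdet.ne_zero
    exact ContinuousAt.comp_continuousWithinAt (continuousAt_matrix_inv _ hinv)
      (hΩc.comp_continuousOn hpath s hs)
  have hbcont : ContinuousOn b (Set.Icc t0 T) := by
    refine continuousOn_pi.mpr fun k => ContinuousOn.add
      ((contDiff_lieFIter hf (hφk k) _).continuous.comp_continuousOn hpath) ?_
    simp only [halfSqDeriv]
    refine continuousOn_const.mul (continuousOn_finsetSum _ fun p hp => ?_)
    have hp' := Finset.HasAntidiagonal.mem_antidiagonal.mp hp
    exact continuousOn_const.mul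
      ((hz_cont k p.1 (by omega)).mul (hz_cont k p.2 (by omega)))
  have hucont : ContinuousOn u (Set.Icc t0 T) := by
    refine ContinuousOn.congr (ContinuousOn.neg ?_) hu'
    rw [continuousOn_iff_continuous_domRestrict] at hΩcont hbcont ⊢
    exact hΩcont.matrix_mulVec hbcont
  have hrhs : ContinuousOn (fun s a => f (s, x s) a + ∑ i, g (s, x s) a i * u s i)
      (Set.Icc t0 T) := by
    have hfc := hf.continuous.comp_continuousOn hpath
    have hgc := hg.continuous.comp_continuousOn hpath
    refine continuousOn_pi.mpr fun a => (continuousOn_pi.mp hfc a).add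
      (continuousOn_finsetSum _ fun i _ => ?_)
    exact (continuousOn_pi.mp (continuousOn_pi.mp hgc a) i).mul (continuousOn_pi.mp hucont i)
  have hxd := hasDerivWithinAt_of_eq_add_integral hT.le hrhs hx
  have hx0 : x t0 = x0 := by simpa using hx t0 (Set.left_mem_Icc.mpr hT.le)
  intro t ht k
  have hΩu : ∀ s ∈ Set.Icc t0 T,
      ∑ i, lieG g (lieFIter f (fun q => φ q k) (ρ k - 1)) (s, x s) i * u s i = -b s k := by
    intro s hs
    have hdet : IsUnit (Ω (s, x s)).det := (Matrix.isUnit_iff_isUnit_det _).mp (hΩ (s, x s))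
    have h : (Ω (s, x s)).mulVec (u s) = -b s := by
      rw [hu' s hs, Matrix.mulVec_neg, Matrix.mulVec_mulVec, Matrix.mul_nonsing_inv _ hdet,
        Matrix.one_mulVec]
    exact congrFun h k
  -- the derivatives of `φ_k(s, x s) + z_k(s)² / 2` along the trajectory
  let e : ℕ → ℝ → ℝ := fun i s => if i < ρ k then
    lieFIter f (fun q => φ q k) i (s, x s) + halfSqDeriv (fun j => z k j s) i else 0
  have he : ∀ i ≤ ρ k, ∀ s ∈ Set.Icc t0 T, e i s = 0 := by
    refine eq_zero_of_hasDerivWithinAt_chain (fun i hi s hs => ?_) (fun i hi => ?_)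
      (fun s _ => by simp [e])
    · have hd := (hasDerivWithinAt_comp_trajectory
        ((contDiff_lieFIter hf (hφk k) i).differentiable (by simp)) (hxd s hs)).fun_add
        (hasDerivWithinAt_halfSqDeriv (z := z k) (i := i)
          fun j hj => hz_deriv k j (by omega) s hs)
      have hei : e i = fun s => lieFIter f (fun q => φ q k) i (s, x s) +
          halfSqDeriv (fun j => z k j s) i := by
        funext r; simp only [e, if_pos hi]
      rw [hei]
      refine hd.congr_deriv ?_
      rw [← lieFIter_succ]
      rcases Nat.lt_or_ge (i + 1) (ρ k) with h | h
      · simp [e, h, hrel1 k i h]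
      · obtain rfl : i = ρ k - 1 := by omega
        rw [hΩu s hs]
        simp only [e, b, Nat.sub_add_cancel (hρ k), lt_irrefl, if_false]
        ring
    · simp only [e, if_pos hi, hx0]
      rcases Nat.eq_zero_or_pos i with rfl | hpos
      · rw [halfSqDeriv_zero, hz_init k 0 hi]
        exact hz00 k
      · rw [halfSqDeriv_of_pos _ hpos, hz_init k 0 (hρ k), hz_init k i hi, ← add_assoc,
          ← hz0i k i hpos (by omega)]
        congr 2
        refine Finset.sum_congr rfl fun j hj => ?_
        rw [Finset.mem_Ico] at hj
        rw [hz_init k (i - j) (by omega), hz_init k j (by omega)]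
  have h := he 0 (Nat.zero_le _) t ht
  have hpos : 0 < ρ k := hρ k
  simp only [e, if_pos hpos, halfSqDeriv_zero] at h
  have hφ0 : lieFIter f (fun q => φ q k) 0 (t, x t) = φ (t, x t) k := rfl
  nlinarith [sq_nonneg (z k 0 t)]
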